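/- Let n, S, T, N be positive integers with S > n, and let X ⊆ ℝⁿ be a closed set with 0 in its interior. Let α₁,…,α_N : ℝⁿ → ℝ be continuous with α_i(x) ≥ 0 and Σ_{i=1}^N α_i(x) = 1 for all x ∈ ℝⁿ. Let Z : ℝⁿ → ℝ^S be continuous with Z(0) = 0 and Z(x) = (x, Ẑ(x)) for some Ẑ : ℝⁿ → ℝ^{S−n}. Let 𝓛₁,…,𝓛_N ∈ ℝ^{(S−n)×S} and set L(x) := Σ_{i=1}^N α_i(x) 𝓛_i, partitioned as L(x) = [L₁(x) L₂(x)] with L₂(x) ∈ ℝ^{(S−n)×(S−n)}; assume that for every x ∈ X, L(x)·Z(x) = 0 and L₂(x) is invertible. Let X₁ ∈ ℝ^{n×T} and G₁,…,G_N ∈ ℝ^{T×S}; set G(x) := Σ_{i=1}^N α_i(x) G_i = [Ḡ(x) G̲(x)] with Ḡ(x) ∈ ℝ^{T×n}, define Ā(x) := X₁·Ḡ(x) − X₁·G̲(x)·L₂(x)⁻¹·L₁(x) for x ∈ X, and F(x) := X₁·G(x)·Z(x). Suppose there exist symmetric positive definite matrices P₁,…,P_N ∈ ℝ^{n×n} such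 that, with P(x) := Σ_{i=1}^N α_i(x) P_i, the matrix P(x) − Ā(x)ᵀ·P(x′)·Ā(x) is positive definite for all x, x′ ∈ X. Then the origin of x_{t+1} = F(x_t) is locally asymptotically stable: F(0) = 0; for every ε > 0 there exists δ > 0 such that ‖x₀‖ ≤ δ implies ‖F^k(x₀)‖ ≤ ε for all k ∈ ℕ; and there exists a set Ω ⊆ X with 0 in its interior that is positively invariant for F (F(Ω) ⊆ Ω) and such that F^k(x₀) → 0 as k → ∞ for every x₀ ∈ Ω. -/

import Mathlib

open Matrix Filter

/-- The Euclidean norm of a vector in `ℝⁿ`. -/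
noncomputable def enorm9 {n : ℕ} (x : Fin n → ℝ) : ℝ := Real.sqrt (∑ i, x i ^ 2)

/-- LaSalle-type lemma: a continuous strict Lyapunov function for a continuous discrete-time system
on a neighbourhood `X` of the equilibrium yields arbitrarily small positively invariant
neighbourhoods of attraction. -/
theorem exists_invariant_nhds_tendsto {E : Type*} [NormedAddCommGroup E] [ProperSpace E]
    {F : E → E} {V : E → ℝ} {X : Set E} (hF : Continuous F) (hF0 : F 0 = 0)
    (hV : Continuous V) (hV0 : V 0 = 0) (hVpos : ∀ x, x ≠ 0 → 0 < V x) (hX : X ∈ nhds 0)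
    (hdec : ∀ x ∈ X, F x ∈ X → x ≠ 0 → V (F x) < V x) :
    ∃ Ω ⊆ X, Ω ∈ nhds 0 ∧ (∀ x ∈ Ω, F x ∈ Ω) ∧
      ∀ x ∈ Ω, Tendsto (fun k => F^[k] x) atTop (nhds 0) := by
  obtain ⟨r, hr, hrX⟩ := Metric.nhds_basis_closedBall.mem_iff.1 hX
  have hFr : F ⁻¹' Metric.closedBall 0 r ∩ Metric.closedBall 0 r ∈ nhds (0 : E) := by
    refine inter_mem (hF.continuousAt.preimage_mem_nhds ?_) (Metric.closedBall_mem_nhds _ hr)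
    rw [hF0]
    exact Metric.closedBall_mem_nhds _ hr
  obtain ⟨ρ, hρ, hρr⟩ := Metric.nhds_basis_closedBall.mem_iff.1 hFr
  obtain ⟨c, hc, hcV⟩ := ((isCompact_closedBall (0 : E) r).diff
    (Metric.isOpen_ball (x := (0 : E)) (ε := ρ))).exists_forall_le' (a := 0) hV.continuousOn (by
      rintro x ⟨-, hx⟩
      refine hVpos x ?_
      rintro rfl
      exact hx (Metric.mem_ball_self hρ))
  have hle : ∀ x ∈ X, F x ∈ X → V (F x) ≤ V x := by
    intro x hx hFx
    by_cases h : x = 0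
    · simp [h, hF0]
    · exact (hdec x hx hFx h).le
  set Ω : Set E := Metric.closedBall 0 ρ ∩ {x | V x ≤ c / 2} with hΩ
  have hΩc : IsCompact Ω :=
    (isCompact_closedBall 0 ρ).inter_right (isClosed_le hV continuous_const)
  have hΩX : Ω ⊆ X := fun x hx => hrX (hρr hx.1).2
  have hΩF : ∀ x ∈ Ω, F x ∈ Ω := by
    intro x hx
    have hFx : F x ∈ Metric.closedBall 0 r := (hρr hx.1).1
    have hVF : V (F x) ≤ c / 2 := (hle x (hΩX hx) (hrX hFx)).trans hx.2
    refine ⟨?_, hVF⟩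
    by_contra h
    have := hcV (F x) ⟨hFx, fun h' => h (Metric.ball_subset_closedBall h')⟩
    linarith
  refine ⟨Ω, hΩX, ?_, hΩF, ?_⟩
  · refine inter_mem (Metric.closedBall_mem_nhds _ hρ) ?_
    refine hV.continuousAt.preimage_mem_nhds (Iic_mem_nhds ?_)
    rw [hV0]
    linarith
  · intro x hx
    have horb : ∀ k, F^[k] x ∈ Ω := by
      intro k
      induction k with
      | zero => exact hx
      | succ k ih => rw [Function.iterate_succ_apply']; exact hΩF _ ih
    have hanti : Antitone fun k => V (F^[k] x) := by
      refine antitone_nat_of_succ_le fun k => ?_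
      rw [Function.iterate_succ_apply']
      exact hle _ (hΩX (horb k)) (hΩX (hΩF _ (horb k)))
    have hVnn : ∀ y, 0 ≤ V y := by
      intro y
      by_cases h : y = 0
      · simp [h, hV0]
      · exact (hVpos y h).le
    have hlim := tendsto_atTop_ciInf hanti
      ⟨0, by rintro _ ⟨k, rfl⟩; exact hVnn _⟩
    set l := ⨅ k, V (F^[k] x)
    have hlim' : Tendsto (fun k => V (F (F^[k] x))) atTop (nhds l) := by
      simpa only [Function.comp_def, Function.iterate_succ_apply'] using
        hlim.comp (tendsto_add_atTop_nat 1)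
    refine hΩc.tendsto_nhds_of_unique_mapClusterPt (Eventually.of_forall horb) ?_
    intro y hy hcl
    by_contra hy0
    have key : ∀ f : E → ℝ, Continuous f →
        Tendsto (fun k => f (F^[k] x)) atTop (nhds l) → f y = l := fun f hf hfl =>
      eq_of_nhds_neBot <| (hcl.continuousAt_comp hf.continuousAt).clusterPt.mono hfl
    have h := hdec y (hΩX hy) (hΩX (hΩF y hy)) hy0
    rw [key V hV hlim, key (fun z => V (F z)) (hV.comp hF) hlim'] at h
    exact lt_irrefl _ h

theorem continuous_enorm9 {n : ℕ} : Continuous (enorm9 (n := n)) := by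
  unfold enorm9
  fun_prop

theorem norm_le_enorm9 {n : ℕ} (x : Fin n → ℝ) : ‖x‖ ≤ enorm9 x := by
  refine (pi_norm_le_iff_of_nonneg (Real.sqrt_nonneg _)).2 fun i => ?_
  exact Real.abs_le_sqrt
    (Finset.single_le_sum (f := fun i => x i ^ 2) (fun _ _ => sq_nonneg _) (Finset.mem_univ i))

theorem mulVec_eq_inl_add_inr {n s m : Type*} [Fintype n] [Fintype s]
    (M : Matrix m (n ⊕ s) ℝ) (z : n ⊕ s → ℝ) :
    M *ᵥ z = M.submatrix id Sum.inl *ᵥ (z ∘ Sum.inl) +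
      M.submatrix id Sum.inr *ᵥ (z ∘ Sum.inr) := by
  ext i
  simp [Matrix.mulVec, dotProduct, Fintype.sum_sum_type]

/-- Elimination of the algebraic variables of a descriptor system. -/
theorem mulVec_eq_schur_mulVec {n s m : Type*} [Fintype n] [Fintype s] [DecidableEq s]
    (M : Matrix m (n ⊕ s) ℝ) (L : Matrix s (n ⊕ s) ℝ) (z : n ⊕ s → ℝ)
    (hLz : L *ᵥ z = 0) (hL : IsUnit (L.submatrix id Sum.inr)) :
    M *ᵥ z = (M.submatrix id Sum.inl - M.submatrix id Sum.inr * (L.submatrix id Sum.inr)⁻¹ *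
      L.submatrix id Sum.inl) *ᵥ (z ∘ Sum.inl) := by
  rw [mulVec_eq_inl_add_inr, add_eq_zero_iff_eq_neg] at hLz
  rw [mulVec_eq_inl_add_inr M, sub_mulVec, ← mulVec_mulVec, hLz, mulVec_neg, ← mulVec_mulVec,
    mulVec_mulVec _ _⁻¹, nonsing_inv_mul _ ((isUnit_iff_isUnit_det _).1 hL), one_mulVec]
  simp

/-- Descriptor embedding, local case (Theorem 3 of the paper): when the algebraic
constraint, invertibility of `L₂(x)` and the Lyapunov decrease condition hold only on a
closed set `X` with `0` in its interior, the origin of `x_{t+1} = X₁ G(x_t) Z(x_t)` is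
locally asymptotically stable, with a positively invariant region `Ω ⊆ X`.
The index type `Fin n ⊕ Fin s` plays the role of `ℝ^S` with `S = n + s > n`. -/
theorem stmt9 (n s T N : ℕ) (hn : 0 < n) (hs : 0 < s) (hT : 0 < T) (hN : 0 < N)
    (X : Set (Fin n → ℝ)) (hXc : IsClosed X) (hX0 : (0 : Fin n → ℝ) ∈ interior X)
    (α : Fin N → (Fin n → ℝ) → ℝ)
    (hαc : ∀ i, Continuous (α i))
    (hα0 : ∀ i x, 0 ≤ α i x) (hα1 : ∀ x, ∑ i, α i x = 1)
    (Z : (Fin n → ℝ) → (Fin n ⊕ Fin s → ℝ))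
    (hZc : Continuous Z) (hZ0 : Z 0 = 0)
    (hZx : ∀ x i, Z x (Sum.inl i) = x i)
    (𝓛 : Fin N → Matrix (Fin s) (Fin n ⊕ Fin s) ℝ)
    (L : (Fin n → ℝ) → Matrix (Fin s) (Fin n ⊕ Fin s) ℝ)
    (hL : ∀ x, L x = ∑ i, α i x • 𝓛 i)
    (hLZ : ∀ x ∈ X, L x *ᵥ Z x = 0)
    (hL₂ : ∀ x ∈ X, IsUnit ((L x).submatrix id Sum.inr))
    (X₁ : Matrix (Fin n) (Fin T) ℝ)
    (G : Fin N → Matrix (Fin T) (Fin n ⊕ Fin s) ℝ)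
    (Gx : (Fin n → ℝ) → Matrix (Fin T) (Fin n ⊕ Fin s) ℝ)
    (hG : ∀ x, Gx x = ∑ i, α i x • G i)
    (Abar : (Fin n → ℝ) → Matrix (Fin n) (Fin n) ℝ)
    (hAbar : ∀ x ∈ X, Abar x =
      X₁ * (Gx x).submatrix id Sum.inl -
        X₁ * (Gx x).submatrix id Sum.inr * ((L x).submatrix id Sum.inr)⁻¹ *
          (L x).submatrix id Sum.inl)
    (F : (Fin n → ℝ) → (Fin n → ℝ))
    (hF : ∀ x, F x = (X₁ * Gx x) *ᵥ Z x)
    (P : Fin N → Matrix (Fin n) (Fin n) ℝ) (hP : ∀ i, (P i).PosDef)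
    (hLyap : ∀ x ∈ X, ∀ x' ∈ X,
      ((∑ i, α i x • P i) - (Abar x)ᵀ * (∑ i, α i x' • P i) * Abar x).PosDef) :
    F 0 = 0 ∧
    (∀ ε > 0, ∃ δ > 0, ∀ x₀ : Fin n → ℝ, enorm9 x₀ ≤ δ →
      ∀ k : ℕ, enorm9 (F^[k] x₀) ≤ ε) ∧
    (∃ Ω : Set (Fin n → ℝ), Ω ⊆ X ∧ (0 : Fin n → ℝ) ∈ interior Ω ∧
      (∀ x ∈ Ω, F x ∈ Ω) ∧
      ∀ x₀ ∈ Ω, Tendsto (fun k => F^[k] x₀) atTop (nhds 0)) := by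
  have hFc : Continuous F := by
    have : F = fun x => (X₁ * ∑ i, α i x • G i) *ᵥ Z x := by ext1 x; rw [hF, hG]
    rw [this]
    fun_prop
  have hF0 : F 0 = 0 := by rw [hF, hZ0, mulVec_zero]
  have hFA : ∀ x ∈ X, F x = Abar x *ᵥ x := by
    intro x hx
    have hz : Z x ∘ Sum.inl = x := funext (hZx x)
    rw [hF, hAbar x hx, mulVec_eq_schur_mulVec _ (L x) _ (hLZ x hx) (hL₂ x hx), hz]
    rfl
  set V : (Fin n → ℝ) → ℝ := fun x => x ⬝ᵥ ((∑ i, α i x • P i) *ᵥ x) with hVdef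
  have hV : Continuous V := by fun_prop
  have hVpos : ∀ x, x ≠ 0 → 0 < V x := by
    intro x hx
    have hq : ∀ i, 0 < x ⬝ᵥ (P i *ᵥ x) := fun i => by
      simpa using (hP i).dotProduct_mulVec_pos hx
    have hVx : V x = ∑ i, α i x * (x ⬝ᵥ (P i *ᵥ x)) := by
      simp [hVdef, sum_mulVec, dotProduct_sum, smul_mulVec]
    rw [hVx]
    refine Finset.sum_pos' (fun i _ => mul_nonneg (hα0 i x) (hq i).le) ?_
    by_contra! h
    have hα : ∀ i, α i x = 0 := fun i => le_antisymm
      (by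
        by_contra! hi
        exact (mul_pos hi (hq i)).not_ge (h i (Finset.mem_univ i))) (hα0 i x)
    simpa [hα] using hα1 x
  have hdec : ∀ x ∈ X, F x ∈ X → x ≠ 0 → V (F x) < V x := by
    intro x hx hFx hx0
    have h := (hLyap x hx (F x) hFx).dotProduct_mulVec_pos hx0
    have hVF : V (F x) =
        x ⬝ᵥ (((Abar x)ᵀ * (∑ i, α i (F x) • P i) * Abar x) *ᵥ x) := by
      rw [← mulVec_mulVec, ← mulVec_mulVec, ← hFA x hx, mulVec_transpose, dotProduct_comm x,
        ← dotProduct_mulVec, ← hFA x hx, dotProduct_comm]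
    rw [star_trivial, sub_mulVec, dotProduct_sub, ← hVF] at h
    exact sub_pos.1 h
  have hloc : ∀ U ∈ nhds (0 : Fin n → ℝ), ∃ Ω ⊆ X ∩ U, Ω ∈ nhds 0 ∧ (∀ x ∈ Ω, F x ∈ Ω) ∧
      ∀ x ∈ Ω, Tendsto (fun k => F^[k] x) atTop (nhds 0) := fun U hU =>
    exists_invariant_nhds_tendsto hFc hF0 hV (by simp [hVdef]) hVpos
      (inter_mem (mem_interior_iff_mem_nhds.1 hX0) hU)
      fun x hx hFx => hdec x hx.1 hFx.1
  refine ⟨hF0, ?_, ?_⟩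
  · intro ε hε
    obtain ⟨Ω, hΩ, hΩ0, hΩF, -⟩ := hloc {x | enorm9 x < ε}
      (continuous_enorm9.continuousAt.preimage_mem_nhds (Iio_mem_nhds (by simpa [enorm9] using hε)))
    obtain ⟨δ, hδ, hδΩ⟩ := Metric.nhds_basis_closedBall.mem_iff.1 hΩ0
    refine ⟨δ, hδ, fun x hx k => ?_⟩
    have hxΩ : x ∈ Ω := hδΩ (mem_closedBall_zero_iff.2 ((norm_le_enorm9 x).trans hx))
    exact (hΩ (Set.MapsTo.iterate hΩF k hxΩ)).2.le
  · obtain ⟨Ω, hΩ, hΩ0, hΩF, hlim⟩ := hloc Set.univ univ_mem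
    exact ⟨Ω, fun x hx => (hΩ hx).1, mem_interior_iff_mem_nhds.2 hΩ0, hΩF, hlim⟩
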